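/- arXiv:2512.10693 — 2 statements merged into one kernel-verified Lean document; each statement's English description precedes it below -/
import Mathlib

section
/- Let t ≥ 1 and let T₁, …, T_t be random variables taking values in the positive integers such that for every i and every natural number k, ℙ(Tᵢ > k) ≤ qᵢ^k, where q₁, …, q_t ∈ [0, 1). Let δ₁, …, δ_t be nonnegative reals. Then 𝔼[ max_i δᵢ Tᵢ ] ≤ (max_i δᵢ) · (ln t + 3) / (min_i (1 − qᵢ)). -/
open MeasureTheory ENNReal

/-- The layer-cake formula for random variables with values in the natural numbers. -/
lemma lintegral_natCast_eq_tsum {Ω : Type*} [MeasurableSpace Ω] (μ : Measure Ω)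
    {X : Ω → ℕ} (hX : Measurable X) :
    ∫⁻ ω, (X ω : ℝ≥0∞) ∂μ = ∑' k : ℕ, μ {ω | k < X ω} := by
  have hset (k : ℕ) : MeasurableSet {ω | k < X ω} := hX measurableSet_Ioi
  have hcount (ω : Ω) :
      (X ω : ℝ≥0∞) = ∑' k : ℕ, {ω | k < X ω}.indicator (fun _ => (1 : ℝ≥0∞)) ω := by
    rw [tsum_eq_sum (s := Finset.range (X ω))]
    · rw [Finset.sum_congr rfl (g := fun _ => (1 : ℝ≥0∞))]
      · simp
      · intro k hk
        simpa [Set.indicator] using hk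
    · intro k hk
      simpa [Set.indicator] using hk
  simp_rw [hcount]
  rw [lintegral_tsum fun k => (measurable_const.indicator (hset k)).aemeasurable]
  simp [lintegral_indicator, hset]

/-- The expected excess over `N` of a random variable with a geometric tail. -/
lemma lintegral_natCast_sub_le {Ω : Type*} [MeasurableSpace Ω] (μ : Measure Ω)
    {X : Ω → ℕ} (hX : Measurable X) {r : ℝ} (hr₀ : 0 ≤ r) (hr₁ : r < 1)
    (htail : ∀ k : ℕ, μ {ω | k < X ω} ≤ ENNReal.ofReal (r ^ k)) (N : ℕ) :
    ∫⁻ ω, ((X ω - N : ℕ) : ℝ≥0∞) ∂μ ≤ ENNReal.ofReal (r ^ N / (1 - r)) := by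
  have hsum : HasSum (fun k : ℕ => r ^ (k + N)) (r ^ N / (1 - r)) := by
    simpa only [pow_add, mul_comm, div_eq_mul_inv] using
      (hasSum_geometric_of_lt_one hr₀ hr₁).mul_left (r ^ N)
  rw [lintegral_natCast_eq_tsum μ (X := fun ω => X ω - N) (by fun_prop), ← hsum.tsum_eq,
    ENNReal.ofReal_tsum_of_nonneg (fun k => by positivity) hsum.summable]
  refine ENNReal.tsum_le_tsum fun k => ?_
  simpa only [Nat.lt_sub_iff_add_lt] using htail (k + N)

/-- At `N = ⌈log t / p⌉`, splitting the expected maximum of `t` geometric variables with success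
probability `p` gives at most `(log t + 3) / p`. -/
lemma ceil_add_mul_pow_div_le {t : ℝ} (ht : 1 ≤ t) {p : ℝ} (hp₀ : 0 < p) (hp₁ : p ≤ 1) :
    (⌈Real.log t / p⌉₊ : ℝ) + t * ((1 - p) ^ ⌈Real.log t / p⌉₊ / p) ≤ (Real.log t + 3) / p := by
  set N := ⌈Real.log t / p⌉₊
  have ht₀ : 0 < t := by linarith
  have hceil : (N : ℝ) < Real.log t / p + 1 :=
    Nat.ceil_lt_add_one (div_nonneg (Real.log_nonneg ht) hp₀.le)
  have hlog : Real.log t ≤ N * p := (div_le_iff₀ hp₀).1 (Nat.le_ceil _)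
  have hpow : t * (1 - p) ^ N ≤ 1 := by
    calc t * (1 - p) ^ N
        ≤ Real.exp (Real.log t) * Real.exp (-p) ^ N := by
          rw [Real.exp_log ht₀]
          gcongr
          exact Real.one_sub_le_exp_neg p
      _ = Real.exp (Real.log t - N * p) := by
          rw [← Real.exp_nat_mul, ← Real.exp_add]
          ring_nf
      _ ≤ 1 := Real.exp_le_one_iff.2 (by linarith)
  have hone : 1 ≤ 1 / p := (one_le_div hp₀).2 hp₁
  have hexcess : t * ((1 - p) ^ N / p) ≤ 1 / p := by
    rw [← mul_div_assoc]
    gcongr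
  rw [add_div, show (3 : ℝ) / p = 3 * (1 / p) by ring]
  linarith

/-- A weighted maximum is at most the largest weight times a threshold plus the sum of the
excesses over it. -/
lemma iSup_mul_natCast_le {t : ℕ} {δ : Fin t → ℝ} (hδ : ∀ i, 0 ≤ δ i) (n : Fin t → ℕ) (N : ℕ) :
    ⨆ i, δ i * (n i : ℝ) ≤ (⨆ i, δ i) * ((N + ∑ i, (n i - N) : ℕ) : ℝ) := by
  have hsup : 0 ≤ ⨆ i, δ i := Real.iSup_nonneg hδ
  refine Real.iSup_le (fun i => ?_) (by positivity)
  have hle : n i ≤ N + ∑ j, (n j - N) := by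
    have := Finset.single_le_sum (f := fun j => n j - N) (fun _ _ => Nat.zero_le _)
      (Finset.mem_univ i)
    omega
  gcongr
  exact le_ciSup (Set.finite_range δ).bddAbove i

/-- Core estimate in the proof of the paper's Proposition 2 (expected depth of
the parallel RSP&V stage of distributed CliNR): if `Tᵢ` are positive-integer
valued with `ℙ(Tᵢ > k) ≤ qᵢ^k`, `qᵢ ∈ [0,1)`, and `δᵢ ≥ 0`, then
`𝔼[max_i δᵢ Tᵢ] ≤ (max_i δᵢ) (ln t + 3) / (min_i (1 − qᵢ))`. -/
theorem expected_max_depth_le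
    {Ω : Type*} [MeasurableSpace Ω] (μ : Measure Ω) [IsProbabilityMeasure μ]
    (t : ℕ) (ht : 1 ≤ t)
    (T : Fin t → Ω → ℕ) (hTmeas : ∀ i, Measurable (T i))
    (hTpos : ∀ i ω, 1 ≤ T i ω)
    (q : Fin t → ℝ) (hq : ∀ i, q i ∈ Set.Ico (0 : ℝ) 1)
    (htail : ∀ (i : Fin t) (k : ℕ),
      μ {ω | k < T i ω} ≤ ENNReal.ofReal (q i ^ k))
    (δ : Fin t → ℝ) (hδ : ∀ i, 0 ≤ δ i) :
    ∫⁻ ω, ENNReal.ofReal (⨆ i, δ i * (T i ω : ℝ)) ∂μ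
      ≤ ENNReal.ofReal ((⨆ i, δ i) * (Real.log t + 3) / (⨅ i, 1 - q i)) := by
  have : Nonempty (Fin t) := ⟨⟨0, ht⟩⟩
  set p := ⨅ i, 1 - q i
  have hp_le (i : Fin t) : p ≤ 1 - q i := ciInf_le (Set.finite_range _).bddBelow i
  have hp₀ : 0 < p := by
    obtain ⟨i, hi⟩ := exists_eq_ciInf_of_finite (f := fun i => 1 - q i)
    change 1 - q i = p at hi
    linarith [(hq i).2]
  have hp₁ : p ≤ 1 := by linarith [hp_le ⟨0, ht⟩, (hq ⟨0, ht⟩).1]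
  have hsup : 0 ≤ ⨆ i, δ i := Real.iSup_nonneg hδ
  have ht₁ : (1 : ℝ) ≤ t := by exact_mod_cast ht
  set N := ⌈Real.log t / p⌉₊
  have hexcess (i : Fin t) :
      ∫⁻ ω, ((T i ω - N : ℕ) : ℝ≥0∞) ∂μ ≤ ENNReal.ofReal ((1 - p) ^ N / p) := by
    have h := lintegral_natCast_sub_le μ (hTmeas i) (r := 1 - p) (by linarith) (by linarith)
      (fun k => (htail i k).trans (ENNReal.ofReal_le_ofReal
        (pow_le_pow_left₀ (hq i).1 (by linarith [hp_le i]) k))) N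
    rwa [_root_.sub_sub_cancel] at h
  have hmeas (i : Fin t) : Measurable fun ω => ((T i ω - N : ℕ) : ℝ≥0∞) := by
    have := hTmeas i
    fun_prop
  have hpow : 0 ≤ (1 - p) ^ N / p := div_nonneg (pow_nonneg (by linarith) N) hp₀.le
  calc ∫⁻ ω, ENNReal.ofReal (⨆ i, δ i * (T i ω : ℝ)) ∂μ
      ≤ ∫⁻ ω, ENNReal.ofReal (⨆ i, δ i) * (N + ∑ i, ((T i ω - N : ℕ) : ℝ≥0∞)) ∂μ := by
        refine lintegral_mono fun ω => ?_
        refine (ENNReal.ofReal_le_ofReal (iSup_mul_natCast_le hδ (fun i => T i ω) N)).trans_eq ?_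
        rw [ENNReal.ofReal_mul hsup, ENNReal.ofReal_natCast, Nat.cast_add, Nat.cast_sum]
    _ = ENNReal.ofReal (⨆ i, δ i) * (N + ∑ i, ∫⁻ ω, ((T i ω - N : ℕ) : ℝ≥0∞) ∂μ) := by
        rw [lintegral_const_mul' _ _ ENNReal.ofReal_ne_top, lintegral_add_left measurable_const,
          lintegral_finsetSum _ fun i _ => hmeas i]
        simp
    _ ≤ ENNReal.ofReal (⨆ i, δ i) * (N + ∑ _i : Fin t, ENNReal.ofReal ((1 - p) ^ N / p)) := by
        gcongr with i
        exact hexcess i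
    _ = ENNReal.ofReal ((⨆ i, δ i) * (N + t * ((1 - p) ^ N / p))) := by
        rw [ENNReal.ofReal_mul hsup, ENNReal.ofReal_add (by positivity) (by positivity),
          ENNReal.ofReal_mul (by positivity), ENNReal.ofReal_natCast, ENNReal.ofReal_natCast]
        simp
    _ ≤ ENNReal.ofReal ((⨆ i, δ i) * (Real.log t + 3) / p) := by
        rw [mul_div_assoc]
        gcongr
        exact ceil_add_mul_pow_div_le ht₁ hp₀ hp₁
end

section
/- Let t ≥ 1, let T₁, …, T_t be random variables with values in the positive integers satisfying ℙ(Tᵢ > k) ≤ qᵢ^k for all natural k, where qᵢ ∈ [0, 1), let δ₁, …, δ_t ≥ 0, and let c ≥ 0 and t ≥ 1 be reals. Then 𝔼[ max( max_i δᵢ Tᵢ , c ) + 4t ] ≤ (max_i δᵢ)(ln t + 3)/(min_i (1 − qᵢ)) + c + 4t. -/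
open MeasureTheory ENNReal

/-- A natural number is the number of indices strictly below it. -/
lemma natCast_eq_tsum_indicator (n : ℕ) :
    (n : ℝ≥0∞) = ∑' k : ℕ, Set.indicator {k : ℕ | k < n} (fun _ => (1 : ℝ≥0∞)) k := by
  rw [tsum_eq_sum (s := Finset.range n)]
  · rw [Finset.sum_congr rfl (g := fun _ => (1 : ℝ≥0∞))]
    · simp
    · intro k hk
      simpa using hk
  · intro k hk
    simpa using hk

/-- A geometric tail bound controls the expected excess over a level `m`. -/
lemma lintegral_natCast_tsub_le_of_tail_le {Ω : Type*} [MeasurableSpace Ω] (μ : Measure Ω)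
    (T : Ω → ℕ) (hT : Measurable T) (q : ℝ) (hq0 : 0 ≤ q) (hq1 : q < 1)
    (htail : ∀ k : ℕ, μ {ω | k < T ω} ≤ ENNReal.ofReal (q ^ k)) (m : ℕ) :
    ∫⁻ ω, ((T ω - m : ℕ) : ℝ≥0∞) ∂μ ≤ ENNReal.ofReal (q ^ m * (1 - q)⁻¹) := by
  have hmeas (k : ℕ) : MeasurableSet {ω | m + k < T ω} :=
    measurableSet_lt measurable_const hT
  calc ∫⁻ ω, ((T ω - m : ℕ) : ℝ≥0∞) ∂μ
      = ∫⁻ ω, ∑' k : ℕ, Set.indicator {ω | m + k < T ω} (fun _ => (1 : ℝ≥0∞)) ω ∂μ := by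
        refine lintegral_congr fun ω => ?_
        rw [natCast_eq_tsum_indicator]
        refine tsum_congr fun k => ?_
        simp only [Set.indicator_apply, Set.mem_ofPred_eq, Nat.lt_sub_iff_add_lt']
    _ = ∑' k : ℕ, μ {ω | m + k < T ω} := by
        rw [lintegral_tsum fun k => (measurable_const.indicator (hmeas k)).aemeasurable]
        exact tsum_congr fun k => by rw [lintegral_indicator_const (hmeas k), one_mul]
    _ ≤ ∑' k : ℕ, ENNReal.ofReal (q ^ (m + k)) := ENNReal.tsum_le_tsum fun k => htail _
    _ = ENNReal.ofReal (q ^ m * (1 - q)⁻¹) := by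
        simp only [pow_add]
        rw [← ENNReal.ofReal_tsum_of_nonneg (fun k => by positivity)
          ((summable_geometric_of_lt_one hq0 hq1).mul_left _), tsum_mul_left,
          tsum_geometric_of_lt_one hq0 hq1]

/-- Past the level `log t / p`, a geometric tail of rate `q ≤ 1 - p` has mass at most
`1 / (t p)`. -/
lemma pow_mul_inv_one_sub_le {t p q : ℝ} (ht : 0 < t) (hp : 0 < p) (hq0 : 0 ≤ q)
    (hpq : p ≤ 1 - q) {m : ℕ} (hm : Real.log t / p ≤ m) :
    q ^ m * (1 - q)⁻¹ ≤ t⁻¹ * p⁻¹ := by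
  have hq1 : 0 < 1 - q := hp.trans_le hpq
  have hexp : q ≤ Real.exp (-p) := by linarith [Real.add_one_le_exp (-p)]
  have hpow : q ^ m ≤ t⁻¹ := by
    calc q ^ m ≤ Real.exp (-p) ^ m := by gcongr
      _ = Real.exp (m * -p) := (Real.exp_nat_mul _ _).symm
      _ ≤ Real.exp (-Real.log t) := by
          gcongr
          rw [div_le_iff₀ hp] at hm
          linarith
      _ = t⁻¹ := by rw [Real.exp_neg, Real.exp_log ht]
  gcongr

/-- Paper's Proposition 2 (expected depth of distributed CliNR), made precise:
if `Tᵢ` are positive-integer valued with `ℙ(Tᵢ > k) ≤ qᵢ^k`, `qᵢ ∈ [0,1)`,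
`δᵢ ≥ 0`, and `c ≥ 0` (the entanglement generation depth `n·τ_e`), then
`𝔼[max(max_i δᵢ Tᵢ, c) + 4t] ≤ (max_i δᵢ)(ln t + 3)/(min_i (1 − qᵢ)) + c + 4t`. -/
theorem distributed_clinr_expected_depth_le
    {Ω : Type*} [MeasurableSpace Ω] (μ : Measure Ω) [IsProbabilityMeasure μ]
    (t : ℕ) (ht : 1 ≤ t)
    (T : Fin t → Ω → ℕ) (hTmeas : ∀ i, Measurable (T i))
    (hTpos : ∀ i ω, 1 ≤ T i ω)
    (q : Fin t → ℝ) (hq : ∀ i, q i ∈ Set.Ico (0 : ℝ) 1)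
    (htail : ∀ (i : Fin t) (k : ℕ),
      μ {ω | k < T i ω} ≤ ENNReal.ofReal (q i ^ k))
    (δ : Fin t → ℝ) (hδ : ∀ i, 0 ≤ δ i)
    (c : ℝ) (hc : 0 ≤ c) :
    ∫⁻ ω, ENNReal.ofReal (max (⨆ i, δ i * (T i ω : ℝ)) c + 4 * t) ∂μ
      ≤ ENNReal.ofReal
          ((⨆ i, δ i) * (Real.log t + 3) / (⨅ i, 1 - q i) + c + 4 * t) := by
  have : Nonempty (Fin t) := ⟨⟨0, ht⟩⟩
  have ht0 : (0 : ℝ) < t := by exact_mod_cast ht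
  have hlog : 0 ≤ Real.log t := Real.log_natCast_nonneg t
  set D := ⨆ i, δ i with hD
  set p := ⨅ i, 1 - q i with hp_def
  have hδD (i) : δ i ≤ D := le_ciSup (Set.finite_range δ).bddAbove i
  have hD0 : 0 ≤ D := (hδ ⟨0, ht⟩).trans (hδD _)
  have hpq (i) : p ≤ 1 - q i := ciInf_le (Set.finite_range fun i => 1 - q i).bddBelow i
  have hp : 0 < p := by
    obtain ⟨i, hi⟩ := exists_eq_ciInf_of_finite (f := fun i => 1 - q i)
    rw [hp_def, ← hi]
    linarith [(hq i).2]
  have hp1 : p ≤ 1 := (hpq ⟨0, ht⟩).trans (by linarith [(hq ⟨0, ht⟩).1])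
  set m := ⌈Real.log t / p⌉₊
  have hm : Real.log t / p ≤ m := Nat.le_ceil _
  have hm' : (m : ℝ) ≤ Real.log t / p + 1 := (Nat.ceil_lt_add_one (by positivity)).le
  have hpoint (ω) : max (⨆ i, δ i * (T i ω : ℝ)) c + 4 * t
      ≤ (D * m + c + 4 * t) + D * ∑ i, ((T i ω - m : ℕ) : ℝ) := by
    have hsup : (⨆ i, δ i * (T i ω : ℝ)) ≤ D * (m + ∑ i, ((T i ω - m : ℕ) : ℝ)) := by
      refine ciSup_le fun i => ?_
      have h1 : (T i ω : ℝ) ≤ m + ((T i ω - m : ℕ) : ℝ) := by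
        exact_mod_cast (by omega : T i ω ≤ m + (T i ω - m))
      have h2 : ((T i ω - m : ℕ) : ℝ) ≤ ∑ i, ((T i ω - m : ℕ) : ℝ) :=
        Finset.single_le_sum (f := fun i => ((T i ω - m : ℕ) : ℝ))
          (fun _ _ => Nat.cast_nonneg _) (Finset.mem_univ i)
      exact mul_le_mul (hδD i) (h1.trans (by gcongr)) (Nat.cast_nonneg _) hD0
    have hnonneg : 0 ≤ D * (m + ∑ i, ((T i ω - m : ℕ) : ℝ)) := by positivity
    have hmax : max (⨆ i, δ i * (T i ω : ℝ)) c ≤ D * (m + ∑ i, ((T i ω - m : ℕ) : ℝ)) + c :=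
      max_le (by linarith) (by linarith)
    linarith
  have hmeas (i) : Measurable fun ω => ((T i ω - m : ℕ) : ℝ≥0∞) :=
    (measurable_from_top (f := fun n : ℕ => ((n - m : ℕ) : ℝ≥0∞))).comp (hTmeas i)
  calc ∫⁻ ω, ENNReal.ofReal (max (⨆ i, δ i * (T i ω : ℝ)) c + 4 * t) ∂μ
      ≤ ∫⁻ ω, (ENNReal.ofReal (D * m + c + 4 * t)
          + ENNReal.ofReal D * ∑ i, ((T i ω - m : ℕ) : ℝ≥0∞)) ∂μ := by
        refine lintegral_mono fun ω => (ENNReal.ofReal_le_ofReal (hpoint ω)).trans_eq ?_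
        rw [ENNReal.ofReal_add (by positivity) (by positivity), ENNReal.ofReal_mul hD0,
          ENNReal.ofReal_sum_of_nonneg fun _ _ => Nat.cast_nonneg _]
        simp only [ENNReal.ofReal_natCast]
    _ = ENNReal.ofReal (D * m + c + 4 * t)
          + ENNReal.ofReal D * ∑ i, ∫⁻ ω, ((T i ω - m : ℕ) : ℝ≥0∞) ∂μ := by
        rw [lintegral_add_left measurable_const, lintegral_const, measure_univ, mul_one,
          lintegral_const_mul _ (Finset.measurable_fun_sum _ fun i _ => hmeas i),
          lintegral_finsetSum _ fun i _ => hmeas i]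
    _ ≤ ENNReal.ofReal (D * m + c + 4 * t)
          + ENNReal.ofReal D * ∑ _i : Fin t, ENNReal.ofReal ((t : ℝ)⁻¹ * p⁻¹) := by
        gcongr with i
        exact (lintegral_natCast_tsub_le_of_tail_le μ (T i) (hTmeas i) (q i) (hq i).1 (hq i).2
          (htail i) m).trans
          (ENNReal.ofReal_le_ofReal (pow_mul_inv_one_sub_le ht0 hp (hq i).1 (hpq i) hm))
    _ = ENNReal.ofReal ((D * m + c + 4 * t) + D * p⁻¹) := by
        rw [← ENNReal.ofReal_sum_of_nonneg fun _ _ => by positivity, ← ENNReal.ofReal_mul hD0,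
          ← ENNReal.ofReal_add (by positivity) (by positivity)]
        congr 3
        simp [ht0.ne']
    _ ≤ ENNReal.ofReal (D * (Real.log t + 3) / p + c + 4 * t) := by
        refine ENNReal.ofReal_le_ofReal ?_
        have hinv : 1 ≤ p⁻¹ := (one_le_inv₀ hp).2 hp1
        have hle : (m : ℝ) + p⁻¹ ≤ (Real.log t + 3) / p := by
          rw [add_div, div_eq_mul_inv 3 p]
          linarith
        have := mul_le_mul_of_nonneg_left hle hD0
        rw [mul_div_assoc]
        linarith
end
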